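/- For 1 ≤ k ≤ n−1, b⁺(n,k) = (−1)^k x_k w_k in ℂW, where x_k = x_{S∖{s_k}} and w_k is the longest element of ⟨s_1,…,s_{k−1}⟩. -/

import Mathlib

open scoped Classical
open MonoidAlgebra Finset Equiv

noncomputable section

namespace DPRSym

variable (n : ℕ)

/-- The simple reflection `s_i` (1-based, `1 ≤ i ≤ n-1`) of the symmetric group
`S_n = Perm (Fin n)`: the transposition of the (0-based) points `i-1` and `i`. -/
def sgen (i : ℕ) : Equiv.Perm (Fin n) :=
  if h : 0 < i ∧ i < n then Equiv.swap ⟨i - 1, by omega⟩ ⟨i, h.2⟩ else 1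

/-- The Coxeter generating set `S = {s_1, …, s_{n-1}}` of `S_n`. -/
def Simples : Finset (Equiv.Perm (Fin n)) := (Finset.Icc 1 (n - 1)).image (sgen n)

/-- The Coxeter length of a permutation: the length of a shortest word in the
generators `S` expressing it. -/
def len (w : Equiv.Perm (Fin n)) : ℕ :=
  sInf {k | ∃ L : List (Equiv.Perm (Fin n)),
    (∀ x ∈ L, x ∈ Simples n) ∧ L.length = k ∧ L.prod = w}

/-- The `i`-cycle `c_i = s_{i-1} ⋯ s_2 s_1` (with `c_1 = 1`). -/
def cgen (i : ℕ) : Equiv.Perm (Fin n) :=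
  (((List.range (i - 1)).reverse).map (fun j => sgen n (j + 1))).prod

/-- The set `W^I` of minimal length left coset representatives of `W_I`,
computed inside the subset `H` (take `H = Set.univ` for the absolute case). -/
def minCoset (H : Set (Equiv.Perm (Fin n))) (I : Finset (Equiv.Perm (Fin n))) :
    Finset (Equiv.Perm (Fin n)) :=
  Finset.univ.filter (fun w => w ∈ H ∧ ∀ s ∈ I, len n w < len n (w * s))

/-- The element `x_I = ∑_{w ∈ W^I} w` of the group algebra. -/
def xRel (H : Set (Equiv.Perm (Fin n))) (I : Finset (Equiv.Perm (Fin n))) :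
    MonoidAlgebra ℂ (Equiv.Perm (Fin n)) :=
  ∑ w ∈ minCoset n H I, of ℂ (Equiv.Perm (Fin n)) w

/-- `w(Δ_J) ⊆ Δ_D`: for every `s ∈ J`, `wsw⁻¹ ∈ D` and `ℓ(ws) = ℓ(w) + 1`. -/
def Takes (D : Finset (Equiv.Perm (Fin n))) (w : Equiv.Perm (Fin n))
    (J : Finset (Equiv.Perm (Fin n))) : Prop :=
  ∀ s ∈ J, w * s * w⁻¹ ∈ D ∧ len n (w * s) = len n w + 1

/-- `ᵂJ = wJw⁻¹`. -/
def conjF (w : Equiv.Perm (Fin n)) (J : Finset (Equiv.Perm (Fin n))) :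
    Finset (Equiv.Perm (Fin n)) :=
  J.image (fun s => w * s * w⁻¹)

/-- The coefficient `m_{JK}` (for `σ ≡ 1`: the number of `w ∈ W^K` with
`w(Δ_J) ⊆ Δ`), relative to the pair `(H, D)`. -/
def mC (H : Set (Equiv.Perm (Fin n))) (D : Finset (Equiv.Perm (Fin n)))
    (J K : Finset (Equiv.Perm (Fin n))) : ℕ :=
  if J ⊆ K then ((minCoset n H K).filter (fun w => Takes n D w J)).card else 0

/-- The family `(e_J)` of BBHT quasi-idempotents for `σ ≡ 1`, relative to `(H, D)`:
the unique solution of the triangular system `x_K = ∑_{J ⊆ K} m_{JK} e_J`, `K ⊆ D`. -/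
def IsBBHT (H : Set (Equiv.Perm (Fin n))) (D : Finset (Equiv.Perm (Fin n)))
    (e : Finset (Equiv.Perm (Fin n)) → MonoidAlgebra ℂ (Equiv.Perm (Fin n))) : Prop :=
  ∀ K ∈ D.powerset, xRel n H K = ∑ J ∈ K.powerset, (mC n H D J K : ℂ) • e J

/-- `b⁺(m, k)`: the coefficient of `t^k` in `(1 - c_1 t)(1 - c_2 t) ⋯ (1 - c_m t)`,
a polynomial with coefficients in the group algebra `ℂ S_n`. -/
def bplus (m k : ℕ) : MonoidAlgebra ℂ (Equiv.Perm (Fin n)) :=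
  (((List.range m).map (fun i =>
      1 - Polynomial.C (of ℂ (Equiv.Perm (Fin n)) (cgen n (i + 1))) * Polynomial.X)).prod).coeff k

/-- The transposition of the 0-based points `a` and `b` (junk value `1` if out of range). -/
def fswap (a b : ℕ) : Equiv.Perm (Fin n) :=
  if h : a < n ∧ b < n then Equiv.swap ⟨a, h.1⟩ ⟨b, h.2⟩ else 1

section Exchange

variable {n}

theorem sgen_apply_val {i : ℕ} (hi : 0 < i) (hin : i < n) (x : Fin n) :
    (sgen n i x : ℕ) = if (x : ℕ) = i - 1 then i else if (x : ℕ) = i then i - 1 else x := by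
  rw [sgen, dif_pos ⟨hi, hin⟩, Equiv.swap_apply_def]
  simp only [Fin.ext_iff]
  split_ifs <;> rfl

theorem mem_Simples {s : Equiv.Perm (Fin n)} :
    s ∈ Simples n ↔ ∃ i, 0 < i ∧ i < n ∧ sgen n i = s := by
  simp only [Simples, Finset.mem_image, Finset.mem_Icc]
  constructor
  · rintro ⟨i, hi, rfl⟩
    exact ⟨i, by omega, by omega, rfl⟩
  · rintro ⟨i, h0, hi, rfl⟩
    exact ⟨i, by omega, rfl⟩

theorem sgen_ne {i k : ℕ} (hi : 0 < i) (hin : i < n) (hk : 0 < k) (hkn : k < n) (h : i ≠ k) :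
    sgen n i ≠ sgen n k := by
  intro e
  have h1 := sgen_apply_val hi hin ⟨i, hin⟩
  have h2 := sgen_apply_val hk hkn ⟨i, hin⟩
  have h3 := sgen_apply_val hi hin ⟨i - 1, by omega⟩
  have h4 := sgen_apply_val hk hkn ⟨i - 1, by omega⟩
  rw [e] at h1 h3
  simp only at h1 h2 h3 h4
  split_ifs at h1 h2 h3 h4 <;> omega

theorem sgen_mul_self (i : ℕ) : sgen n i * sgen n i = 1 := by
  unfold sgen
  split_ifs <;> simp

/-- Every permutation is a product of simple reflections. -/
theorem exists_word (w : Equiv.Perm (Fin n)) :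
    ∃ L : List (Equiv.Perm (Fin n)), (∀ x ∈ L, x ∈ Simples n) ∧ L.prod = w := by
  cases n with
  | zero => exact ⟨[], by simp, Subsingleton.elim _ _⟩
  | succ m =>
    have hw : w ∈ Submonoid.closure
        (Set.range fun i : Fin m => Equiv.swap i.castSucc i.succ) := by
      rw [Equiv.Perm.mclosure_swap_castSucc_succ]
      trivial
    obtain ⟨L, hL, hp⟩ := Submonoid.exists_list_of_mem_closure hw
    refine ⟨L, fun x hx => ?_, hp⟩
    obtain ⟨i, rfl⟩ := hL x hx
    refine mem_Simples.2 ⟨i + 1, by omega, by omega, ?_⟩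
    rw [sgen, dif_pos (by omega)]
    rfl

/-- The strong exchange property of words in the simple reflections. -/
theorem exists_shorter_word {a b : Fin n} (hab : a < b) (L : List (Equiv.Perm (Fin n)))
    (hL : ∀ x ∈ L, x ∈ Simples n) (h : L.prod b < L.prod a) :
    ∃ L' : List (Equiv.Perm (Fin n)), (∀ x ∈ L', x ∈ Simples n) ∧ L'.length < L.length ∧
      L'.prod = L.prod * Equiv.swap a b := by
  induction L with
  | nil => exact absurd h (by simpa using hab.le)
  | cons t L ih =>
    have hL' : ∀ x ∈ L, x ∈ Simples n := fun x hx => hL x (List.mem_cons_of_mem _ hx)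
    have ht : t ∈ Simples n := hL t List.mem_cons_self
    by_cases hlt : L.prod b < L.prod a
    · obtain ⟨M, hM, hlen, hprod⟩ := ih hL' hlt
      refine ⟨t :: M, ?_, by simpa using hlen, by simp [hprod, mul_assoc]⟩
      intro x hx
      rcases List.mem_cons.1 hx with rfl | hx
      exacts [ht, hM x hx]
    · refine ⟨L, hL', by simp, ?_⟩
      have hne : L.prod a ≠ L.prod b := fun e => hab.ne (L.prod.injective e)
      obtain ⟨i, h0, hi, rfl⟩ := mem_Simples.1 ht
      rw [List.prod_cons, Equiv.Perm.mul_apply, Equiv.Perm.mul_apply, Fin.lt_def,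
        sgen_apply_val h0 hi, sgen_apply_val h0 hi] at h
      rw [Fin.lt_def] at hlt
      rw [Ne, Fin.ext_iff] at hne
      have hpq : (L.prod a : ℕ) = i - 1 ∧ (L.prod b : ℕ) = i := by
        split_ifs at h <;> omega
      have hs : sgen n i = Equiv.swap (L.prod a) (L.prod b) := by
        rw [sgen, dif_pos ⟨h0, hi⟩]
        congr 1 <;> ext <;> simp [hpq]
      rw [List.prod_cons, hs, mul_assoc, Equiv.mul_swap_eq_swap_mul, ← mul_assoc,
        Equiv.swap_mul_self, one_mul]

theorem len_mul_swap_lt {w : Equiv.Perm (Fin n)} {a b : Fin n} (hab : a < b) (h : w b < w a) :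
    len n (w * Equiv.swap a b) < len n w := by
  have hne : {k | ∃ L : List (Equiv.Perm (Fin n)),
      (∀ x ∈ L, x ∈ Simples n) ∧ L.length = k ∧ L.prod = w}.Nonempty := by
    obtain ⟨L, hL, hp⟩ := exists_word w
    exact ⟨_, L, hL, rfl, hp⟩
  obtain ⟨L, hL, hlen, hp⟩ := Nat.sInf_mem hne
  subst hp
  obtain ⟨M, hM, hlt, hM'⟩ := exists_shorter_word hab L hL h
  refine lt_of_le_of_lt (Nat.sInf_le ⟨M, hM, rfl, hM'⟩) ?_
  rw [hlen] at hlt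
  exact hlt

theorem len_lt_len_mul_sgen_iff (w : Equiv.Perm (Fin n)) {i : ℕ} (hi : 0 < i) (hin : i < n) :
    len n w < len n (w * sgen n i) ↔ w ⟨i - 1, by omega⟩ < w ⟨i, hin⟩ := by
  have hs : sgen n i = Equiv.swap ⟨i - 1, by omega⟩ ⟨i, hin⟩ := dif_pos ⟨hi, hin⟩
  have hab : (⟨i - 1, by omega⟩ : Fin n) < ⟨i, hin⟩ := Fin.lt_def.2 (by simp; omega)
  constructor
  · intro h
    by_contra hlt
    have hgt := lt_of_le_of_ne (not_lt.1 hlt) (fun e => hab.ne' (w.injective e))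
    have := len_mul_swap_lt hab hgt
    rw [← hs] at this
    omega
  · intro h
    have := len_mul_swap_lt (w := w * sgen n i) hab (by rw [hs]; simpa using h)
    rwa [← hs, mul_assoc, sgen_mul_self, mul_one] at this

theorem mem_minCoset_maximal_iff {k : ℕ} (hk : 0 < k) (hkn : k < n) (w : Equiv.Perm (Fin n)) :
    w ∈ minCoset n Set.univ (Simples n \ {sgen n k}) ↔
      ∀ i (hi : 0 < i) (hin : i < n), i ≠ k → w ⟨i - 1, by omega⟩ < w ⟨i, hin⟩ := by
  simp only [minCoset, Finset.mem_filter, Finset.mem_univ, Set.mem_univ, true_and,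
    Finset.mem_sdiff, Finset.mem_singleton]
  constructor
  · intro h i hi hin hne
    exact (len_lt_len_mul_sgen_iff w hi hin).1
      (h _ ⟨mem_Simples.2 ⟨i, hi, hin, rfl⟩, sgen_ne hi hin hk hkn hne⟩)
  · rintro h s ⟨hs, hne⟩
    obtain ⟨i, hi, hin, rfl⟩ := mem_Simples.1 hs
    exact (len_lt_len_mul_sgen_iff w hi hin).2 (h i hi hin (fun e => hne (e ▸ rfl)))

end Exchange

section Valley

variable {n}

theorem cgen_apply_val {m : ℕ} (hm : m < n) (x : Fin n) :
    (cgen n (m + 1) x : ℕ) = if (x : ℕ) = 0 then m else if (x : ℕ) ≤ m then x - 1 else x := by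
  induction m with
  | zero =>
    simp only [cgen]
    split_ifs <;> simp <;> omega
  | succ m ih =>
    have hc : cgen n (m + 1 + 1) = sgen n (m + 1) * cgen n (m + 1) := by
      simp [cgen, List.range_succ]
    rw [hc, Equiv.Perm.mul_apply, sgen_apply_val (by omega) hm, ih (by omega)]
    split_ifs <;> omega

theorem cgen_inv_apply_val {m : ℕ} (hm : m < n) (x : Fin n) :
    (((cgen n (m + 1))⁻¹ x : Fin n) : ℕ)
      = if (x : ℕ) = m then 0 else if (x : ℕ) < m then (x : ℕ) + 1 else (x : ℕ) := by
  have h := cgen_apply_val hm ((cgen n (m + 1))⁻¹ x)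
  rw [← Equiv.Perm.mul_apply, mul_inv_cancel, Equiv.Perm.one_apply] at h
  split_ifs at h ⊢ <;> omega

/-- `σ` decreases on the first `k` points, increases on the remaining ones, and fixes every
point from the `m`-th (0-based) on. -/
def IsValley (m k : ℕ) (σ : Equiv.Perm (Fin n)) : Prop :=
  k ≤ m ∧ (∀ a b : Fin n, a < b → (b : ℕ) < k → σ b < σ a) ∧
    (∀ a b : Fin n, a < b → k ≤ (a : ℕ) → σ a < σ b) ∧ ∀ j : Fin n, m ≤ (j : ℕ) → σ j = j

theorem apply_val_lt_of_fixes {m : ℕ} {σ : Equiv.Perm (Fin n)}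
    (h : ∀ j : Fin n, m ≤ (j : ℕ) → σ j = j) {x : Fin n} (hx : (x : ℕ) < m) :
    (σ x : ℕ) < m := by
  by_contra hlt
  have := σ.injective (h (σ x) (by omega))
  rw [this] at hlt
  exact hlt hx

theorem IsValley.succ {m k : ℕ} {σ : Equiv.Perm (Fin n)} (h : IsValley m k σ) :
    IsValley (m + 1) k σ :=
  ⟨h.1.trans (Nat.le_succ m), h.2.1, h.2.2.1, fun j hj => h.2.2.2 j (by omega)⟩

theorem IsValley.mul_cgen {m k : ℕ} (hm : m < n) {τ : Equiv.Perm (Fin n)} (h : IsValley m k τ) :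
    IsValley (m + 1) (k + 1) (τ * cgen n (m + 1)) := by
  obtain ⟨hkm, hdec, hinc, hfix⟩ := h
  refine ⟨by omega, fun a b hab hb => ?_, fun a b hab ha => ?_, fun j hj => ?_⟩
  all_goals simp only [Equiv.Perm.mul_apply]
  · have ca := cgen_apply_val hm a
    have cb := cgen_apply_val hm b
    rw [Fin.lt_def] at hab
    rw [if_neg (by omega), if_pos (by omega)] at cb
    by_cases h0 : (a : ℕ) = 0
    · rw [if_pos h0] at ca
      rw [hfix (cgen n (m + 1) a) (by omega), Fin.lt_def, ca]
      exact apply_val_lt_of_fixes hfix (by omega)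
    · rw [if_neg h0, if_pos (by omega)] at ca
      exact hdec _ _ (Fin.lt_def.2 (by omega)) (by omega)
  · have ca := cgen_apply_val hm a
    have cb := cgen_apply_val hm b
    rw [Fin.lt_def] at hab
    apply hinc
    · rw [Fin.lt_def]
      split_ifs at ca cb <;> omega
    · split_ifs at ca <;> omega
  · have cj : cgen n (m + 1) j = j := by
      ext
      rw [cgen_apply_val hm, if_neg (by omega), if_neg (by omega)]
    rw [cj, hfix j (by omega)]

theorem IsValley.isValley_or {m k : ℕ} (hm : m < n) {σ : Equiv.Perm (Fin n)}
    (h : IsValley (m + 1) (k + 1) σ) :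
    IsValley m (k + 1) σ ∨ IsValley m k (σ * (cgen n (m + 1))⁻¹) := by
  obtain ⟨hkm, hdec, hinc, hfix⟩ := h
  obtain ⟨p, hp⟩ := σ.surjective ⟨m, hm⟩
  have hpm : (p : ℕ) ≤ m := by
    by_contra hlt
    have := hfix p (by omega)
    rw [hp, Fin.ext_iff] at this
    simp only at this
    omega
  rcases Nat.eq_zero_or_pos (p : ℕ) with h0 | hpos
  · right
    have c0 : ∀ x : Fin n, (x : ℕ) = m → (cgen n (m + 1))⁻¹ x = p := by
      intro x hx
      ext
      rw [cgen_inv_apply_val hm, if_pos hx, h0]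
    have hfix' : ∀ j : Fin n, m ≤ (j : ℕ) → σ ((cgen n (m + 1))⁻¹ j) = j := by
      intro j hj
      rcases hj.eq_or_lt with e | hlt
      · rw [c0 j e.symm, hp]
        exact Fin.ext e
      · have : (cgen n (m + 1))⁻¹ j = j := by
          ext
          rw [cgen_inv_apply_val hm, if_neg (by omega), if_neg (by omega)]
        rw [this, hfix j (by omega)]
    refine ⟨by omega, fun a b hab hb => ?_, fun a b hab ha => ?_, fun j hj => hfix' j hj⟩
    all_goals
      simp only [Equiv.Perm.mul_apply]
      rw [Fin.lt_def] at hab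
      have ca := cgen_inv_apply_val hm a
      have cb := cgen_inv_apply_val hm b
    · rw [if_neg (by omega), if_pos (by omega)] at ca cb
      exact hdec _ _ (Fin.lt_def.2 (by omega)) (by omega)
    · by_cases hb : (b : ℕ) < m
      · rw [if_neg (by omega), if_pos (by omega)] at ca cb
        exact hinc _ _ (Fin.lt_def.2 (by omega)) (by omega)
      · rw [hfix' b (by omega), Fin.lt_def]
        by_cases ham : (a : ℕ) < m
        · exact (apply_val_lt_of_fixes (σ := σ * (cgen n (m + 1))⁻¹) hfix' ham).trans_le
            (by omega)
        · rwa [hfix' a (by omega)]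
  · left
    have hkp : k + 1 ≤ (p : ℕ) := by
      by_contra hlt
      have h1 := hdec ⟨0, by omega⟩ p (Fin.lt_def.2 hpos) (by omega)
      have h2 := apply_val_lt_of_fixes (x := ⟨0, by omega⟩) hfix (by simp)
      rw [hp, Fin.lt_def] at h1
      simp only at h1
      omega
    have hpm' : (p : ℕ) = m := by
      by_contra hne
      have h1 := hinc p ⟨m, hm⟩ (Fin.lt_def.2 (by simp only; omega)) hkp
      have h2 := apply_val_lt_of_fixes (x := ⟨m, hm⟩) hfix (by simp)
      rw [hp, Fin.lt_def] at h1
      simp only at h1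
      omega
    refine ⟨by omega, hdec, hinc, fun j hj => ?_⟩
    rcases hj.eq_or_lt with e | hlt
    · have : j = p := Fin.ext (by omega)
      rw [this, hp]
      exact Fin.ext hpm'.symm
    · exact hfix j hlt

theorem IsValley.not_isValley_mul {m k : ℕ} (hm : m < n) {σ : Equiv.Perm (Fin n)}
    (h : IsValley m (k + 1) σ) : ¬ IsValley m k (σ * (cgen n (m + 1))⁻¹) := by
  intro h'
  have h1 := h.2.2.2 ⟨m, hm⟩ le_rfl
  have h2 := h'.2.2.2 ⟨m, hm⟩ le_rfl
  rw [Equiv.Perm.mul_apply, ← h1, h1] at h2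
  have h3 := congrArg Fin.val (σ.injective (h2.trans h1.symm))
  rw [cgen_inv_apply_val hm, if_pos rfl] at h3
  have := h.1
  simp only at h3
  omega

theorem isValley_zero_right_iff (m : ℕ) (σ : Equiv.Perm (Fin n)) : IsValley m 0 σ ↔ σ = 1 := by
  constructor
  · rintro ⟨-, -, hinc, -⟩
    have hmono : StrictMono σ := fun a b hab => hinc a b hab (Nat.zero_le _)
    ext x
    have := Subsingleton.elim (hmono.orderIsoOfSurjective σ σ.surjective) (OrderIso.refl _)
    exact congrArg (fun f : Fin n ≃o Fin n => (f x : ℕ)) this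
  · rintro rfl
    exact ⟨Nat.zero_le _, fun a b _ hb => absurd hb (Nat.not_lt_zero _), fun a b h _ => h,
      fun _ _ => rfl⟩

theorem bplus_zero_right (m : ℕ) : bplus n m 0 = 1 := by
  induction m with
  | zero => simp [bplus]
  | succ m ih =>
    rw [bplus] at ih ⊢
    rw [List.range_succ, List.map_append, List.prod_append, Polynomial.mul_coeff_zero, ih]
    simp

theorem bplus_succ_succ (m k : ℕ) :
    bplus n (m + 1) (k + 1)
      = bplus n m (k + 1) - bplus n m k * of ℂ (Equiv.Perm (Fin n)) (cgen n (m + 1)) := by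
  simp only [bplus, List.range_succ, List.map_append, List.prod_append, List.map_cons,
    List.map_nil, List.prod_cons, List.prod_nil, mul_one]
  rw [mul_sub, mul_one, Polynomial.coeff_sub, ← mul_assoc, Polynomial.coeff_mul_X,
    Polynomial.coeff_mul_C]

theorem bplus_eq_sum_isValley {m : ℕ} (hm : m ≤ n) (k : ℕ) :
    bplus n m k = (-1 : ℂ) ^ k • ∑ σ : Equiv.Perm (Fin n) with IsValley m k σ,
      of ℂ (Equiv.Perm (Fin n)) σ := by
  induction m generalizing k with
  | zero =>
    cases k with
    | zero =>
      rw [bplus_zero_right]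
      simp only [isValley_zero_right_iff]
      rw [Finset.sum_filter, Finset.sum_ite_eq' Finset.univ 1]
      simp [MonoidAlgebra.one_def]
    | succ k =>
      have : ∀ σ : Equiv.Perm (Fin n), ¬ IsValley 0 (k + 1) σ := fun σ h => by
        have := h.1
        omega
      simp [bplus, this, Polynomial.coeff_one]
  | succ m ih =>
    cases k with
    | zero =>
      rw [bplus_zero_right]
      simp only [isValley_zero_right_iff]
      rw [Finset.sum_filter, Finset.sum_ite_eq' Finset.univ 1]
      simp [MonoidAlgebra.one_def]
    | succ k =>
      have hsplit : (Finset.univ.filter fun σ : Equiv.Perm (Fin n) =>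
            IsValley (m + 1) (k + 1) σ)
          = (Finset.univ.filter fun σ => IsValley m (k + 1) σ) ∪
            Finset.univ.filter fun σ => IsValley m k (σ * (cgen n (m + 1))⁻¹) := by
        ext σ
        simp only [Finset.mem_filter, Finset.mem_univ, true_and, Finset.mem_union]
        refine ⟨fun h => h.isValley_or hm, ?_⟩
        rintro (h | h)
        · exact h.succ
        · simpa using h.mul_cgen hm
      have hdisj : Disjoint (Finset.univ.filter fun σ : Equiv.Perm (Fin n) =>
            IsValley m (k + 1) σ)
          (Finset.univ.filter fun σ => IsValley m k (σ * (cgen n (m + 1))⁻¹)) :=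
        Finset.disjoint_filter.2 fun σ _ h => h.not_isValley_mul hm
      have hshift : ∑ σ : Equiv.Perm (Fin n) with IsValley m k (σ * (cgen n (m + 1))⁻¹),
            of ℂ (Equiv.Perm (Fin n)) σ
          = (∑ σ : Equiv.Perm (Fin n) with IsValley m k σ, of ℂ (Equiv.Perm (Fin n)) σ)
            * of ℂ (Equiv.Perm (Fin n)) (cgen n (m + 1)) := by
        rw [Finset.sum_mul, Finset.sum_filter, Finset.sum_filter,
          ← Equiv.sum_comp (Equiv.mulRight (cgen n (m + 1)))]
        simp only [Equiv.coe_mulRight, mul_inv_cancel_right, map_mul]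
      rw [bplus_succ_succ, ih (by omega), ih (by omega), hsplit, Finset.sum_union hdisj, hshift,
        smul_add, smul_mul_assoc, pow_succ (-1 : ℂ) k]
      simp only [mul_neg, mul_one, neg_smul, sub_eq_add_neg]

theorem isValley_mul_reverse_iff {k : ℕ} (hk1 : 0 < k) (hk : k < n) {wk : Equiv.Perm (Fin n)}
    (hwk : ∀ j : Fin n, ((wk j : ℕ) = if (j : ℕ) < k then k - 1 - (j : ℕ) else (j : ℕ)))
    (w : Equiv.Perm (Fin n)) :
    IsValley n k (w * wk) ↔ w ∈ minCoset n Set.univ (Simples n \ {sgen n k}) := by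
  rw [mem_minCoset_maximal_iff hk1 hk]
  have hinv : ∀ x, wk (wk x) = x := fun x => by
    ext
    rw [hwk, hwk]
    split_ifs <;> omega
  constructor
  · rintro ⟨-, hdec, hinc, -⟩ i hi hin hne
    have ha := hwk ⟨i - 1, by omega⟩
    have hb := hwk ⟨i, hin⟩
    simp only at ha hb
    rcases lt_or_gt_of_ne hne with hlt | hgt
    · rw [if_pos (by omega)] at ha hb
      have := hdec (wk ⟨i, hin⟩) (wk ⟨i - 1, by omega⟩) (Fin.lt_def.2 (by omega)) (by omega)
      simpa only [Equiv.Perm.mul_apply, hinv] using this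
    · rw [if_neg (by omega)] at ha hb
      have := hinc (wk ⟨i - 1, by omega⟩) (wk ⟨i, hin⟩) (Fin.lt_def.2 (by omega)) (by omega)
      simpa only [Equiv.Perm.mul_apply, hinv] using this
  · intro h
    have hlt : ∀ (a : Fin n) (d : ℕ) (hd : (a : ℕ) + d + 1 < n),
        ((a : ℕ) + d + 1 < k ∨ k ≤ (a : ℕ)) → w a < w ⟨(a : ℕ) + d + 1, hd⟩ := by
      intro a d
      induction d with
      | zero => exact fun hd hor => h ((a : ℕ) + 0 + 1) (by omega) hd (by omega)
      | succ d ih =>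
        exact fun hd hor => (ih (by omega) (by omega)).trans
          (h ((a : ℕ) + (d + 1) + 1) (by omega) hd (by omega))
    have hmono : ∀ a b : Fin n, a < b → ((b : ℕ) < k ∨ k ≤ (a : ℕ)) → w a < w b := by
      intro a b hab hor
      rw [Fin.lt_def] at hab
      have e : b = ⟨(a : ℕ) + ((b : ℕ) - a - 1) + 1, by omega⟩ := Fin.ext (by simp only; omega)
      rw [e]
      exact hlt a _ _ (by omega)
    refine ⟨hk.le, fun a b hab hb => ?_, fun a b hab ha => ?_, fun j hj => by omega⟩
    all_goals
      simp only [Equiv.Perm.mul_apply]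
      rw [Fin.lt_def] at hab
      have ca := hwk a
      have cb := hwk b
      apply hmono
    · rw [if_pos (by omega)] at ca cb
      exact Fin.lt_def.2 (by omega)
    · rw [if_pos (by omega)] at ca cb
      omega
    · rw [if_neg (by omega)] at ca cb
      exact Fin.lt_def.2 (by omega)
    · rw [if_neg (by omega)] at ca cb
      omega

end Valley

/-- Corollary 5.3: for `1 ≤ k ≤ n-1`, `b⁺(n, k) = (−1)^k x_k w_k` in `ℂ S_n`,
where `x_k = x_{S∖{s_k}}` and `w_k` is the longest element of `⟨s_1, …, s_{k-1}⟩`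
(the permutation reversing `{1, …, k}` and fixing the other points). -/
theorem stmt11 (hn : 2 ≤ n) (k : ℕ) (hk1 : 1 ≤ k) (hk : k ≤ n - 1)
    (wk : Equiv.Perm (Fin n))
    (hwk : ∀ j : Fin n,
      ((wk j : ℕ) = if (j : ℕ) < k then k - 1 - (j : ℕ) else (j : ℕ))) :
    bplus n n k
      = ((-1 : ℂ)) ^ k •
          (xRel n Set.univ (Simples n \ {sgen n k}) * of ℂ (Equiv.Perm (Fin n)) wk) := by
  have hkn : k < n := by omega
  rw [bplus_eq_sum_isValley le_rfl, xRel, Finset.sum_mul]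
  congr 1
  rw [Finset.sum_filter, ← Equiv.sum_comp (Equiv.mulRight wk)]
  simp only [Equiv.coe_mulRight, isValley_mul_reverse_iff hk1 hkn hwk, map_mul]
  rw [← Finset.sum_filter, Finset.filter_mem_eq_inter, Finset.univ_inter]

end DPRSym
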